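/- If P is a (B+1)-partition of G with value at least v*, then no part of P contains two of the vertices b_1, …, b_k, and every part of P containing some b_i has exactly B + 1 vertices. -/

import Mathlib

open scoped Classical

set_option linter.unnecessarySeqFocus false

/-- Vertices of the bin-packing graph: clique vertices `(j, a)` together with
the `k` bin vertices `b_i`. -/
abbrev BPV (n k : ℕ) (s : Fin n → ℕ) := (Σ j : Fin n, Fin (s j)) ⊕ Fin k

/-- Adjacency: two clique vertices are adjacent iff they share the first
coordinate; every bin vertex is adjacent to every clique vertex; bin vertices
are pairwise non-adjacent. -/
def bpAdj (n k : ℕ) (s : Fin n → ℕ) : BPV n k s → BPV n k s → Prop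
  | Sum.inl x, Sum.inl y => x.1 = y.1 ∧ x ≠ y
  | Sum.inl _, Sum.inr _ => True
  | Sum.inr _, Sum.inl _ => True
  | Sum.inr _, Sum.inr _ => False

/-- The bin-packing graph `G`. -/
def bpGraph (n k : ℕ) (s : Fin n → ℕ) : SimpleGraph (BPV n k s) where
  Adj := bpAdj n k s
  symm := by
    refine ⟨?_⟩
    intro a b h
    cases a <;> cases b <;> simp only [bpAdj] at h ⊢ <;> try trivial
    exact ⟨h.1.symm, fun e => h.2 e.symm⟩
  loopless := by
    refine ⟨?_⟩
    intro a h
    cases a <;> simp_all [bpAdj]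

/-- The number of edges of `G` with both endpoints in `Q`. -/
noncomputable def partVal {V : Type*} [DecidableEq V] (G : SimpleGraph V)
    (Q : Finset V) : ℕ :=
  (Q.sym2.filter (fun e => e ∈ G.edgeSet)).card

/-- The (unweighted) value of a partition `P`: the number of edges of `G` with
both endpoints in a common part of `P`. -/
noncomputable def pVal {V : Type*} [Fintype V] [DecidableEq V] (G : SimpleGraph V)
    (P : Finpartition (Finset.univ : Finset V)) : ℕ :=
  ∑ Q ∈ P.parts, partVal G Q

/-- The edges of `G` joining two clique vertices. -/
noncomputable def cliqueEdges (n k : ℕ) (s : Fin n → ℕ) : Finset (Sym2 (BPV n k s)) :=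
  Finset.univ.biUnion fun j : Fin n =>
    ((Finset.univ : Finset (Fin (s j))).offDiag.image Sym2.mk.uncurry).image
      (Sym2.map fun a => Sum.inl ⟨j, a⟩)

theorem card_cliqueEdges_le (n k : ℕ) (s : Fin n → ℕ) :
    (cliqueEdges n k s).card ≤ ∑ j : Fin n, s j * (s j - 1) / 2 := by
  refine Finset.card_biUnion_le.trans (Finset.sum_le_sum fun j _ => ?_)
  refine Finset.card_image_le.trans ?_
  rw [Sym2.card_image_offDiag, Finset.card_univ, Fintype.card_fin, Nat.choose_two_right]

theorem mem_cliqueEdges {n k : ℕ} {s : Fin n → ℕ} {x y : Σ j : Fin n, Fin (s j)}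
    (h : x.1 = y.1) (hne : x ≠ y) :
    (s(Sum.inl x, Sum.inl y) : Sym2 (BPV n k s)) ∈ cliqueEdges n k s := by
  obtain ⟨j, a⟩ := x
  obtain ⟨j', b⟩ := y
  obtain rfl : j = j' := h
  simp only [cliqueEdges, Finset.mem_biUnion, Finset.mem_image, Finset.mem_univ, true_and]
  refine ⟨j, s(a, b), ⟨(a, b), ?_, rfl⟩, rfl⟩
  simp only [Finset.mem_offDiag, Finset.mem_univ, true_and]
  rintro rfl
  exact hne rfl

/-- Every edge inside `Q` joins two clique vertices or a clique vertex and a bin vertex. -/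
theorem partVal_bpGraph_le {n k : ℕ} {s : Fin n → ℕ} (Q : Finset (BPV n k s)) :
    partVal (bpGraph n k s) Q ≤
      (Q.sym2 ∩ cliqueEdges n k s).card + Q.toRight.card * Q.toLeft.card := by
  have hsub : Q.sym2.filter (fun e => e ∈ (bpGraph n k s).edgeSet) ⊆
      (Q.sym2 ∩ cliqueEdges n k s) ∪
        (Q.toRight ×ˢ Q.toLeft).image fun p => s(Sum.inr p.1, Sum.inl p.2) := by
    intro e
    induction e using Sym2.ind with
    | _ u v =>
      intro he
      obtain ⟨hQ, hadj⟩ := Finset.mem_filter.1 he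
      rw [SimpleGraph.mem_edgeSet] at hadj
      have huv := Finset.mk_mem_sym2_iff.1 hQ
      rw [Finset.mem_union, Finset.mem_inter, Finset.mem_image]
      rcases u with x | i <;> rcases v with y | i'
      · exact Or.inl ⟨hQ, mem_cliqueEdges hadj.1 hadj.2⟩
      · exact Or.inr ⟨(i', x), by simp [huv], Sym2.eq_swap⟩
      · exact Or.inr ⟨(i, y), by simp [huv], rfl⟩
      · exact hadj.elim
  refine (Finset.card_le_card hsub).trans ((Finset.card_union_le _ _).trans ?_)
  gcongr
  exact Finset.card_image_le.trans (Finset.card_product _ _).le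

/-- Pairs inside distinct parts of a partition are distinct. -/
theorem sum_card_sym2_inter_le {V : Type*} [Fintype V] [DecidableEq V]
    (P : Finpartition (Finset.univ : Finset V)) (T : Finset (Sym2 V)) :
    ∑ Q ∈ P.parts, (Q.sym2 ∩ T).card ≤ T.card := by
  rw [← Finset.card_biUnion]
  · exact Finset.card_le_card (Finset.biUnion_subset.2 fun Q _ => Finset.inter_subset_right)
  · intro Q hQ R hR hne
    rw [Function.onFun, Finset.disjoint_left]
    intro e
    induction e using Sym2.ind with
    | _ u v =>
      intro h₁ h₂
      have hu₁ := (Finset.mk_mem_sym2_iff.1 (Finset.mem_inter.1 h₁).1).1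
      have hu₂ := (Finset.mk_mem_sym2_iff.1 (Finset.mem_inter.1 h₂).1).1
      exact Finset.disjoint_left.1 (P.disjoint hQ hR hne) hu₁ hu₂

theorem sum_card_toRight {α β : Type*} [Fintype α] [Fintype β] [DecidableEq (α ⊕ β)]
    (P : Finpartition (Finset.univ : Finset (α ⊕ β))) :
    ∑ Q ∈ P.parts, Q.toRight.card = Fintype.card β := by
  classical
  rw [← Finset.card_biUnion, ← Finset.card_univ]
  · congr 1
    ext b
    obtain ⟨Q, hQ, hb⟩ := P.exists_mem (Finset.mem_univ (Sum.inr b))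
    simp only [Finset.mem_biUnion, Finset.mem_toRight, Finset.mem_univ, iff_true]
    exact ⟨Q, hQ, hb⟩
  · intro Q hQ R hR hne
    rw [Function.onFun, Finset.disjoint_left]
    intro b h₁ h₂
    exact Finset.disjoint_left.1 (P.disjoint hQ hR hne)
      (Finset.mem_toRight.1 h₁) (Finset.mem_toRight.1 h₂)

/-- In any `(B+1)`-partition of value at least `v*`, no part contains two bin
vertices, and every part containing a bin vertex has exactly `B + 1` vertices. -/
theorem stmt7 (n k B : ℕ) (hn : 1 ≤ n) (hk : 1 ≤ k) (hB : 1 ≤ B)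
    (s : Fin n → ℕ) (hs : ∀ j, 1 ≤ s j)
    (P : Finpartition (Finset.univ : Finset (BPV n k s)))
    (hP : ∀ Q ∈ P.parts, Q.card ≤ B + 1)
    (hval : (∑ j : Fin n, s j * (s j - 1) / 2) + k * B ≤ pVal (bpGraph n k s) P) :
    (∀ Q ∈ P.parts, ∀ i i' : Fin k,
      (Sum.inr i : BPV n k s) ∈ Q → (Sum.inr i' : BPV n k s) ∈ Q → i = i') ∧
    (∀ Q ∈ P.parts, (∃ i : Fin k, (Sum.inr i : BPV n k s) ∈ Q) → Q.card = B + 1) := by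
  have hle : ∀ Q ∈ P.parts, Q.toRight.card * Q.toLeft.card ≤ Q.toRight.card * B := by
    intro Q hQ
    rcases Nat.eq_zero_or_pos Q.toRight.card with h | h
    · simp [h]
    · have := hP Q hQ
      have := Q.card_toLeft_add_card_toRight
      exact Nat.mul_le_mul_left _ (by omega)
  have hsum : ∑ Q ∈ P.parts, Q.toRight.card * B ≤
      ∑ Q ∈ P.parts, Q.toRight.card * Q.toLeft.card := by
    rw [← Finset.sum_mul, sum_card_toRight, Fintype.card_fin]
    have hupper : pVal (bpGraph n k s) P ≤
        ∑ Q ∈ P.parts, (Q.sym2 ∩ cliqueEdges n k s).card +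
          ∑ Q ∈ P.parts, Q.toRight.card * Q.toLeft.card := by
      rw [← Finset.sum_add_distrib]
      exact Finset.sum_le_sum fun Q _ => partVal_bpGraph_le Q
    have hclique := (sum_card_sym2_inter_le P (cliqueEdges n k s)).trans
      (card_cliqueEdges_le n k s)
    omega
  have heq := (Finset.sum_eq_sum_iff_of_le hle).1 ((Finset.sum_le_sum hle).antisymm hsum)
  have hcard : ∀ Q ∈ P.parts, ∀ i : Fin k, (Sum.inr i : BPV n k s) ∈ Q →
      Q.toRight.card = 1 ∧ Q.card = B + 1 := by
    intro Q hQ i hi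
    have hpos : 0 < Q.toRight.card := Finset.card_pos.2 ⟨i, Finset.mem_toRight.2 hi⟩
    have hB' := Nat.eq_of_mul_eq_mul_left hpos (heq Q hQ)
    have := hP Q hQ
    have := Q.card_toLeft_add_card_toRight
    omega
  refine ⟨fun Q hQ i i' hi hi' => ?_, fun Q hQ ⟨i, hi⟩ => (hcard Q hQ i hi).2⟩
  exact Finset.card_le_one.1 (hcard Q hQ i hi).1.le i (Finset.mem_toRight.2 hi)
    i' (Finset.mem_toRight.2 hi')
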